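/- Let 1 ≤ p ≤ k be integers. Then there exists a multiset X of k vectors from P = {v ∈ {0,1}^p : v₁ = 1} such that det( Σ_{v∈X} v vᵀ ) ≥ (k^p / 2^{2(p−1)}) · ((k−p+1)/k · p/(p + k(π/2 − 1)))^p. -/

import Mathlib

open Matrix BigOperators

/-- A product of functions of distinct coordinates of independent samples has expectation
the product of the expectations. -/
lemma sum_prod_mul_prod_comp_of_injective {ι κ Ω : Type*} [Fintype ι] [Fintype κ] [DecidableEq κ]
    [Fintype Ω] (μ : Ω → ℝ) (hμ : ∑ ω, μ ω = 1) (f : ι → κ) (hf : Function.Injective f)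
    (g : ι → Ω → ℝ) :
    ∑ x : κ → Ω, (∏ i, μ (x i)) * ∏ a, g a (x (f a)) = ∏ a, ∑ ω, μ ω * g a ω := by
  have hG : ∀ x : κ → Ω, ∏ a, g a (x (f a)) = ∏ i, Function.extend f g 1 i (x i) := fun x =>
    Fintype.prod_of_injective f hf _ _
      (fun i hi => by rw [Function.extend_apply' _ _ _ (by simpa using hi)]; rfl)
      (fun a => by rw [hf.extend_apply])
  simp_rw [hG, ← Finset.prod_mul_distrib]
  rw [← Fintype.prod_sum (fun i ω => μ ω * Function.extend f g 1 i ω)]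
  symm
  refine Fintype.prod_of_injective f hf _ _ (fun i hi => ?_) (fun a => ?_)
  · rw [Function.extend_apply' _ _ _ (by simpa using hi)]
    simpa using hμ
  · rw [hf.extend_apply]

lemma det_sum_vecMulVec_self {ι κ : Type*} [Fintype ι] [DecidableEq ι] [Fintype κ]
    [DecidableEq κ] (v : κ → ι → ℝ) :
    (∑ i, vecMulVec (v i) (v i)).det =
      ∑ f : ι → κ with Function.Injective f,
        ∑ σ : Equiv.Perm ι, (Equiv.Perm.sign σ : ℝ) * ∏ a, (v (f a) a * v (f a) (σ a)) := by
  have hdet : ∀ f : ι → κ,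
      ∑ σ : Equiv.Perm ι, (Equiv.Perm.sign σ : ℝ) * ∏ a, (v (f a) a * v (f a) (σ a)) =
        (∏ a, v (f a) a) * (Matrix.of fun a b => v (f a) b).det := by
    intro f
    rw [← det_transpose, det_apply', Finset.mul_sum]
    refine Finset.sum_congr rfl fun σ _ => ?_
    rw [Finset.prod_mul_distrib]
    simp only [transpose_apply, of_apply]
    ring
  rw [Finset.sum_filter_of_ne, ← det_transpose, det_apply', Finset.sum_comm]
  · refine Finset.sum_congr rfl fun σ _ => ?_
    rw [← Finset.mul_sum, ← Fintype.prod_sum (fun a i => v i a * v i (σ a))]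
    simp [Matrix.sum_apply, vecMulVec_apply]
  · intro f _ hne
    by_contra hf
    apply hne
    obtain ⟨a, b, hab, hne'⟩ := Function.not_injective_iff.1 hf
    rw [hdet, det_zero_of_row_eq hne' (by ext c; simp [hab]), mul_zero]

/-- The expected determinant of a sum of independent rank-one matrices `v vᵀ`. -/
lemma sum_prod_mul_det_sum_vecMulVec {ι κ Ω : Type*} [Fintype ι] [DecidableEq ι] [Fintype κ]
    [DecidableEq κ] [Fintype Ω] (μ : Ω → ℝ) (hμ : ∑ ω, μ ω = 1) (w : Ω → ι → ℝ) :
    ∑ x : κ → Ω, (∏ i, μ (x i)) * (∑ i, vecMulVec (w (x i)) (w (x i))).det =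
      ((Fintype.card κ).descFactorial (Fintype.card ι) : ℝ) *
        (∑ ω, μ ω • vecMulVec (w ω) (w ω)).det := by
  have hcard : (Finset.univ.filter fun f : ι → κ => Function.Injective f).card =
      (Fintype.card κ).descFactorial (Fintype.card ι) := by
    rw [← Fintype.card_embedding_eq, ← Fintype.card_subtype]
    exact Fintype.card_congr (Equiv.subtypeInjectiveEquivEmbedding ι κ)
  simp_rw [det_sum_vecMulVec_self, Finset.mul_sum]
  rw [Finset.sum_comm, ← hcard, ← nsmul_eq_mul, ← Finset.sum_const]
  refine Finset.sum_congr rfl fun f hf => ?_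
  rw [Finset.sum_comm, ← det_transpose, det_apply']
  refine Finset.sum_congr rfl fun σ _ => ?_
  simp_rw [mul_left_comm _ (Equiv.Perm.sign σ : ℝ)]
  rw [← Finset.mul_sum, sum_prod_mul_prod_comp_of_injective μ hμ f (Finset.mem_filter.1 hf).2
    (fun a ω => w ω a * w ω (σ a))]
  simp [Matrix.sum_apply, vecMulVec_apply]

/-- The `±1` vector with sign pattern `ω`, normalized to `1` at coordinate `o`. -/
def signVector {ι : Type*} [DecidableEq ι] (o : ι) (ω : ι → Bool) (i : ι) : ℝ :=
  if i = o then 1 else if ω i then 1 else -1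

lemma sum_signVector_mul_eq_zero {ι : Type*} [Fintype ι] [DecidableEq ι] (o : ι) {i j : ι}
    (hij : i ≠ j) (hi : i ≠ o) :
    ∑ ω : ι → Bool, signVector o ω i * signVector o ω j = 0 := by
  have hflip : Function.Involutive fun ω : ι → Bool => Function.update ω i (!ω i) := by
    intro ω
    simp
  have h := Equiv.sum_comp (hflip.toPerm _) fun ω => signVector o ω i * signVector o ω j
  have hneg : ∀ ω : ι → Bool,
      signVector o (hflip.toPerm _ ω) i * signVector o (hflip.toPerm _ ω) j =
        -(signVector o ω i * signVector o ω j) := by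
    intro ω
    cases hω : ω i <;> simp [signVector, hi, hij.symm, hω] <;> split_ifs <;> simp
  simp_rw [hneg, Finset.sum_neg_distrib] at h
  linarith

lemma sum_vecMulVec_signVector {ι : Type*} [Fintype ι] [DecidableEq ι] (o : ι) :
    ∑ ω : ι → Bool, vecMulVec (signVector o ω) (signVector o ω) =
      (Fintype.card (ι → Bool) : ℝ) • (1 : Matrix ι ι ℝ) := by
  ext i j
  simp only [Matrix.sum_apply, vecMulVec_apply, Matrix.smul_apply, smul_eq_mul]
  by_cases hij : i = j
  · subst hij
    have h : ∀ ω : ι → Bool, signVector o ω i * signVector o ω i = 1 := by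
      intro ω
      unfold signVector
      split_ifs <;> norm_num
    simp [h]
  · rw [one_apply_ne hij, mul_zero]
    by_cases hi : i = o
    · simp_rw [mul_comm (signVector o _ i)]
      exact sum_signVector_mul_eq_zero o (Ne.symm hij) (fun hj => hij (hi.trans hj.symm))
    · exact sum_signVector_mul_eq_zero o hij hi

/-- The linear map `v ↦ (v + v_o 1) / 2`, taking `±1` vectors with `v_o = 1` to `0/1` vectors. -/
noncomputable def signToZeroOne {ι : Type*} [DecidableEq ι] (o : ι) : Matrix ι ι ℝ :=
  Matrix.of fun i j => (if i = j then 1 / 2 else 0) + if j = o then 1 / 2 else 0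

lemma signToZeroOne_mulVec_signVector {ι : Type*} [Fintype ι] [DecidableEq ι] (o : ι)
    (ω : ι → Bool) (i : ι) :
    (signToZeroOne o *ᵥ signVector o ω) i = (signVector o ω i + 1) / 2 := by
  simp only [mulVec, dotProduct, signToZeroOne, of_apply, add_mul, Finset.sum_add_distrib,
    ite_mul, zero_mul, Finset.sum_ite_eq, Finset.sum_ite_eq', Finset.mem_univ, if_true]
  simp only [signVector, if_true]
  ring

lemma det_signToZeroOne {p : ℕ} (hp : 1 ≤ p) :
    (signToZeroOne (⟨0, hp⟩ : Fin p)).det = (1 / 2) ^ (p - 1) := by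
  obtain ⟨n, rfl⟩ : ∃ n, p = n + 1 := ⟨p - 1, by omega⟩
  rw [det_of_isLowerTriangular, Fin.prod_univ_succ]
  · have h : ∀ i : Fin n, signToZeroOne (⟨0, hp⟩ : Fin (n + 1)) i.succ i.succ = 1 / 2 := by
      intro i
      simp [signToZeroOne]
    simp only [h]
    simp [signToZeroOne]
    norm_num
  · intro i j hij
    have hij' : i < j := hij
    have hj : j ≠ ⟨0, hp⟩ := fun h => by simp [h] at hij'
    simp only [signToZeroOne, of_apply, if_neg hij'.ne, if_neg hj, add_zero]

/-- Corollary 1 of the paper: there is a multiset of k design points from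
P = {v ∈ {0,1}^p : v₁ = 1} achieving the stated determinant guarantee. -/
theorem zero_one_design_guarantee
    (p k : ℕ) (hp : 1 ≤ p) (hpk : p ≤ k) :
    ∃ X : Multiset (Fin p → ℝ), Multiset.card X = k ∧
      (∀ v ∈ X, (∀ i, v i = 0 ∨ v i = 1) ∧ v ⟨0, hp⟩ = 1) ∧
      ((X.map fun v => vecMulVec v v).sum).det ≥
        ((k : ℝ) ^ p / 2 ^ (2 * (p - 1))) *
          (((k : ℝ) - p + 1) / k * (p / (p + k * (Real.pi / 2 - 1)))) ^ p := by
  set o : Fin p := ⟨0, hp⟩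
  set T := signToZeroOne o
  set w : (Fin p → Bool) → Fin p → ℝ := fun ω => T *ᵥ signVector o ω with hw
  set N : ℝ := (Fintype.card (Fin p → Bool) : ℝ) with hN
  have hNpos : 0 < N := by rw [hN]; exact_mod_cast Fintype.card_pos
  have hμ : ∑ _ω : Fin p → Bool, N⁻¹ = 1 := by
    rw [Finset.sum_const, Finset.card_univ, nsmul_eq_mul, ← hN, mul_inv_cancel₀ hNpos.ne']
  have hmean : ∑ ω, N⁻¹ • vecMulVec (w ω) (w ω) = T * Tᵀ := by
    have h : ∀ ω, vecMulVec (w ω) (w ω) =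
        T * vecMulVec (signVector o ω) (signVector o ω) * Tᵀ := fun ω => by
      rw [mul_vecMulVec, vecMulVec_mul, vecMul_transpose]
    simp_rw [← Finset.smul_sum, h]
    rw [← Finset.sum_mul, ← Finset.mul_sum, sum_vecMulVec_signVector, ← hN]
    simp [smul_smul, hNpos.ne']
  have havg := sum_prod_mul_det_sum_vecMulVec (κ := Fin k) (fun _ => N⁻¹) hμ w
  rw [hmean, det_mul, det_transpose, det_signToZeroOne hp] at havg
  simp only [Finset.prod_const, Finset.card_univ, Fintype.card_fin] at havg
  set B : ℝ := (k.descFactorial p : ℝ) * ((1 / 2) ^ (p - 1) * (1 / 2) ^ (p - 1)) with hB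
  obtain ⟨x, -, hx⟩ : ∃ x ∈ (Finset.univ : Finset (Fin k → Fin p → Bool)),
      N⁻¹ ^ k * B ≤ N⁻¹ ^ k * (∑ i, vecMulVec (w (x i)) (w (x i))).det := by
    refine Finset.exists_le_of_sum_le Finset.univ_nonempty ?_
    rw [havg, Finset.sum_const, Finset.card_univ, Fintype.card_fun, Fintype.card_fin,
      nsmul_eq_mul, Nat.cast_pow, ← hN, ← mul_assoc, ← mul_pow, mul_inv_cancel₀ hNpos.ne',
      one_pow, one_mul]
  have hx' := le_of_mul_le_mul_left hx (by positivity)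
  refine ⟨Finset.univ.val.map fun i => w (x i), by simp, ?_, ?_⟩
  · intro v hv
    obtain ⟨i, -, rfl⟩ := Multiset.mem_map.1 hv
    simp only [hw, T, signToZeroOne_mulVec_signVector]
    refine ⟨fun j => ?_, by simp [signVector]⟩
    unfold signVector
    split_ifs <;> norm_num
  · rw [Multiset.map_map]
    refine le_trans ?_ hx'
    have hk : (0 : ℝ) < k := by exact_mod_cast hp.trans hpk
    have hp' : (0 : ℝ) < p := by exact_mod_cast hp
    have hpk' : (p : ℝ) ≤ k := by exact_mod_cast hpk
    have hc : 0 ≤ (k : ℝ) * (Real.pi / 2 - 1) :=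
      mul_nonneg hk.le (by linarith [Real.pi_gt_three])
    have hr : (p : ℝ) / (p + k * (Real.pi / 2 - 1)) ≤ 1 :=
      div_le_one_of_le₀ (by linarith) (by linarith)
    have hr0 : 0 ≤ (p : ℝ) / (p + k * (Real.pi / 2 - 1)) := by positivity
    have hdesc : ((k : ℝ) - p + 1) ^ p ≤ k.descFactorial p := by
      have h : (((k + 1 - p : ℕ) : ℝ)) ^ p ≤ k.descFactorial p := by
        exact_mod_cast Nat.pow_sub_le_descFactorial k p
      rw [Nat.cast_sub (by omega)] at h
      push_cast at h
      rwa [show (k : ℝ) - p + 1 = k + 1 - p by ring]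
    have hB' : B = k.descFactorial p / 2 ^ (2 * (p - 1)) := by
      rw [hB, ← pow_add, ← two_mul, one_div, inv_pow, div_eq_mul_inv]
    have h0 : (0 : ℝ) ≤ (k : ℝ) - p + 1 := by linarith
    rw [hB', mul_pow, div_pow]
    calc _ = ((k : ℝ) - p + 1) ^ p * ((p : ℝ) / (p + k * (Real.pi / 2 - 1))) ^ p /
          2 ^ (2 * (p - 1)) := by field_simp
      _ ≤ _ := by
        gcongr
        exact (mul_le_of_le_one_right (by positivity) (pow_le_one₀ hr0 hr)).trans hdesc
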